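/- Let Ψ : (0,∞) → [0,∞) be strictly increasing with ∫₀^∞ 1/(1+Ψ(ζ)) dζ < ∞. Then for all ξ₁, ξ₂ > 0 and every real z > 0, one has φ(ξ₁,z) · φ(ξ₂,z) ≤ φ(z) · φ(ξ₁,ξ₂,z); equivalently, the quantity φ̃(ξ₁,ξ₂,z) := φ(ξ₁,ξ₂,z) − φ(ξ₁,z)φ(ξ₂,z)/φ(z) satisfies φ̃(ξ₁,ξ₂,z) ≥ 0. -/

import Mathlib

open MeasureTheory Filter Topology Set

/-- `φ(z) = (1/π) ∫₀^∞ 1/(Ψ(ζ)+z) dζ`, for real `z`. -/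
noncomputable def phiR (Ψ : ℝ → ℝ) (z : ℝ) : ℝ :=
  (Real.pi)⁻¹ * ∫ ζ in Ioi (0:ℝ), (Ψ ζ + z)⁻¹

/-- `φ(ξ,z) = (1/π) ∫₀^∞ (ξ²/(ξ²+ζ²)) / (Ψ(ζ)+z) dζ`, for real `z`. -/
noncomputable def phi1R (Ψ : ℝ → ℝ) (ξ : ℝ) (z : ℝ) : ℝ :=
  (Real.pi)⁻¹ * ∫ ζ in Ioi (0:ℝ), (ξ^2 / (ξ^2 + ζ^2)) * (Ψ ζ + z)⁻¹

/-- `φ(ξ₁,ξ₂,z) = (1/π) ∫₀^∞ (ξ₁²/(ξ₁²+ζ²))(ξ₂²/(ξ₂²+ζ²)) / (Ψ(ζ)+z) dζ`, for real `z`. -/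
noncomputable def phi2R (Ψ : ℝ → ℝ) (ξ₁ ξ₂ : ℝ) (z : ℝ) : ℝ :=
  (Real.pi)⁻¹ * ∫ ζ in Ioi (0:ℝ),
    (ξ₁^2 / (ξ₁^2 + ζ^2)) * (ξ₂^2 / (ξ₂^2 + ζ^2)) * (Ψ ζ + z)⁻¹

/-- **Chebyshev's integral inequality**: functions that monovary on `s` are positively correlated
with respect to a nonnegative weight `w`. -/
theorem MonovaryOn.setIntegral_mul_setIntegral_le {α : Type*} [MeasurableSpace α]
    {μ : Measure α} {s : Set α} {f g w : α → ℝ} (hs : MeasurableSet s) (hfg : MonovaryOn f g s)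
    (hw_nonneg : ∀ x ∈ s, 0 ≤ w x) (hw : IntegrableOn w s μ)
    (hf : IntegrableOn (fun x => f x * w x) s μ) (hg : IntegrableOn (fun x => g x * w x) s μ)
    (hh : IntegrableOn (fun x => f x * g x * w x) s μ) :
    (∫ x in s, f x * w x ∂μ) * (∫ x in s, g x * w x ∂μ) ≤
      (∫ x in s, w x ∂μ) * ∫ x in s, f x * g x * w x ∂μ := by
  set W := ∫ x in s, w x ∂μ
  set F := ∫ x in s, f x * w x ∂μ
  set G := ∫ x in s, g x * w x ∂μ
  set H := ∫ x in s, f x * g x * w x ∂μ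
  have inner : ∀ x ∈ s, 0 ≤ f x * g x * W - f x * G - g x * F + H := by
    intro x hx
    have key : ∫ y in s, (f x * g x * w y - f x * (g y * w y) - g x * (f y * w y) +
        f y * g y * w y) ∂μ = f x * g x * W - f x * G - g x * F + H := by
      have hwg := (hw.const_mul (f x * g x)).sub (hg.const_mul (f x))
      rw [integral_add (by exact hwg.sub (hf.const_mul (g x))) hh,
        integral_sub (by exact hwg) (hf.const_mul _),
        integral_sub (hw.const_mul _) (hg.const_mul _),
        integral_const_mul, integral_const_mul, integral_const_mul]
    rw [← key]
    refine setIntegral_nonneg hs fun y hy => ?_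
    have := mul_nonneg (monovaryOn_iff_forall_mul_nonneg.1 hfg hx hy) (hw_nonneg y hy)
    linarith
  have outer : ∫ x in s, (W * (f x * g x * w x) - G * (f x * w x) - F * (g x * w x) +
      H * w x) ∂μ = W * H - G * F - F * G + H * W := by
    have hhf := (hh.const_mul W).sub (hf.const_mul G)
    rw [integral_add (by exact hhf.sub (hg.const_mul F)) (hw.const_mul _),
      integral_sub (by exact hhf) (hg.const_mul _), integral_sub (hh.const_mul _) (hf.const_mul _),
      integral_const_mul, integral_const_mul, integral_const_mul, integral_const_mul]
  have : 0 ≤ W * H - G * F - F * G + H * W := by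
    rw [← outer]
    refine setIntegral_nonneg hs fun x hx => ?_
    have := mul_nonneg (inner x hx) (hw_nonneg x hx)
    linarith
  linarith

theorem antitoneOn_sq_div_sq_add_sq {ξ : ℝ} (hξ : 0 < ξ) :
    AntitoneOn (fun ζ : ℝ => ξ ^ 2 / (ξ ^ 2 + ζ ^ 2)) (Ioi 0) := by
  intro x hx y _ hxy
  have hx : 0 < x := hx
  dsimp only
  gcongr

theorem sq_div_sq_add_sq_le_one (ξ ζ : ℝ) : ξ ^ 2 / (ξ ^ 2 + ζ ^ 2) ≤ 1 :=
  div_le_one_of_le₀ (by nlinarith [sq_nonneg ζ]) (by positivity)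

theorem integrableOn_inv_add {Ψ : ℝ → ℝ} (hmono : MonotoneOn Ψ (Ioi 0))
    (hnonneg : ∀ ζ ∈ Ioi (0:ℝ), 0 ≤ Ψ ζ)
    (hint : IntegrableOn (fun ζ => 1 / (1 + Ψ ζ)) (Ioi 0)) {z : ℝ} (hz : 0 < z) :
    IntegrableOn (fun ζ => (Ψ ζ + z)⁻¹) (Ioi 0) := by
  have hmeas : AEMeasurable Ψ (volume.restrict (Ioi 0)) :=
    aemeasurable_restrict_of_monotoneOn measurableSet_Ioi hmono
  refine Integrable.mono' (hint.const_mul ((1 + z) / z))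
    (hmeas.add_const z).inv.aestronglyMeasurable ?_
  filter_upwards [ae_restrict_mem measurableSet_Ioi] with ζ hζ
  have h := hnonneg ζ hζ
  rw [Real.norm_of_nonneg (by positivity), div_mul_div_comm, inv_eq_one_div,
    div_le_div_iff₀ (by positivity) (by positivity)]
  nlinarith [mul_nonneg hz.le h, sq_nonneg z]

theorem phiTilde_nonneg_on_reals (Ψ : ℝ → ℝ)
    (hmono : StrictMonoOn Ψ (Ioi 0))
    (hnonneg : ∀ ζ ∈ Ioi (0:ℝ), 0 ≤ Ψ ζ)
    (hint : IntegrableOn (fun ζ => 1 / (1 + Ψ ζ)) (Ioi 0))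
    (ξ₁ ξ₂ : ℝ) (hξ₁ : 0 < ξ₁) (hξ₂ : 0 < ξ₂) (z : ℝ) (hz : 0 < z) :
    phi1R Ψ ξ₁ z * phi1R Ψ ξ₂ z ≤ phiR Ψ z * phi2R Ψ ξ₁ ξ₂ z ∧
      0 ≤ phi2R Ψ ξ₁ ξ₂ z - phi1R Ψ ξ₁ z * phi1R Ψ ξ₂ z / phiR Ψ z := by
  have hw := integrableOn_inv_add hmono.monotoneOn hnonneg hint hz
  have hw_nonneg : ∀ ζ ∈ Ioi (0:ℝ), 0 ≤ (Ψ ζ + z)⁻¹ := fun ζ hζ => by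
    have := hnonneg ζ hζ
    positivity
  have bdd_mul (ξ : ℝ) {v : ℝ → ℝ} (hv : IntegrableOn v (Ioi 0)) :
      IntegrableOn (fun ζ => ξ ^ 2 / (ξ ^ 2 + ζ ^ 2) * v ζ) (Ioi 0) := by
    refine Integrable.bdd_mul (c := 1) hv
      (Measurable.aestronglyMeasurable (by fun_prop)) (ae_of_all _ fun ζ => ?_)
    rw [Real.norm_of_nonneg (by positivity)]
    exact sq_div_sq_add_sq_le_one ξ ζ
  have chebyshev := ((antitoneOn_sq_div_sq_add_sq hξ₁).monovaryOn
    (antitoneOn_sq_div_sq_add_sq hξ₂)).setIntegral_mul_setIntegral_le (μ := volume)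
    measurableSet_Ioi hw_nonneg hw (bdd_mul ξ₁ hw) (bdd_mul ξ₂ hw)
    (by simpa only [mul_assoc] using bdd_mul ξ₁ (bdd_mul ξ₂ hw))
  have main : phi1R Ψ ξ₁ z * phi1R Ψ ξ₂ z ≤ phiR Ψ z * phi2R Ψ ξ₁ ξ₂ z := by
    unfold phi1R phi2R phiR
    have := mul_le_mul_of_nonneg_left chebyshev (by positivity : 0 ≤ Real.pi⁻¹ * Real.pi⁻¹)
    linarith
  have phiR_nonneg : 0 ≤ phiR Ψ z :=
    mul_nonneg (by positivity) (setIntegral_nonneg measurableSet_Ioi hw_nonneg)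
  have phi2R_nonneg : 0 ≤ phi2R Ψ ξ₁ ξ₂ z :=
    mul_nonneg (by positivity) (setIntegral_nonneg measurableSet_Ioi fun ζ hζ =>
      mul_nonneg (by positivity) (hw_nonneg ζ hζ))
  refine ⟨main, sub_nonneg.2 (div_le_of_le_mul₀ phiR_nonneg phi2R_nonneg ?_)⟩
  rwa [mul_comm (phi2R _ _ _ _)]
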